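/- arXiv:2403.20167 — 2 statements merged into one kernel-verified Lean document; each statement's English description precedes it below -/
import Mathlib

section
/- With ρ and the operator A = ((Id−E_1)∘D_1)∘⋯∘((Id−E_n)∘D_n) as in the context: for every integrable function u : ℝ^n → ℂ, the function A(u), which is defined at almost every point of ℝ^n, is essentially bounded, i.e. A(u) ∈ L^∞(ℝ^n). -/
open Complex Real MeasureTheory Set

noncomputable section

/-- The operator `D_i(g)(x) = ∫_{−∞}^{x_i} g(x; i↦y) dy`. -/
def Dop {n : ℕ} (i : Fin n) (g : (Fin n → ℝ) → ℂ) : (Fin n → ℝ) → ℂ :=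
  fun x => ∫ y in Set.Iic (x i), g (Function.update x i y)

/-- The operator `E_i(g)(x) = ∫_ℝ g(x; i↦y)·ρ(y) dy`. -/
def Eop {n : ℕ} (ρ : ℝ → ℝ) (i : Fin n) (g : (Fin n → ℝ) → ℂ) : (Fin n → ℝ) → ℂ :=
  fun x => ∫ y : ℝ, g (Function.update x i y) * (ρ y : ℂ)

/-- The operator `A = ((Id−E_1)∘D_1)∘⋯∘((Id−E_n)∘D_n)`. -/
def Aop {n : ℕ} (ρ : ℝ → ℝ) (g : (Fin n → ℝ) → ℂ) : (Fin n → ℝ) → ℂ :=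
  (List.finRange n).foldr
    (fun i acc => fun x => Dop i acc x - Eop ρ i (Dop i acc) x) g

theorem aux_ae_update {n : ℕ} (i : Fin n) {p : (Fin n → ℝ) → Prop}
    (hp : ∀ᵐ x ∂(volume : Measure (Fin n → ℝ)), p x) :
    ∀ᵐ x ∂(volume : Measure (Fin n → ℝ)), ∀ᵐ y : ℝ, p (Function.update x i y) := by
  obtain ⟨N, hN, hNm, hN0⟩ := exists_measurable_superset_of_null (ae_iff.1 hp)
  set f : (Fin n → ℝ) → ENNReal := N.indicator 1 with hf
  have hfm : Measurable f := measurable_one.indicator hNm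
  have hf0 : ∫⁻ x, f x ∂(Measure.pi fun _ : Fin n => (volume : Measure ℝ)) = 0 := by
    rw [hf, lintegral_indicator_one hNm]; exact hN0
  set F : (Fin n → ℝ) → ENNReal := fun x => ∫⁻ y, f (Function.update x i y) with hF
  have hFm : Measurable F :=
    Measurable.lintegral_prod_right' (f := fun q : (Fin n → ℝ) × ℝ => f (Function.update q.1 i q.2))
      (hfm.comp measurable_update')
  have h1 : lmarginal (fun _ : Fin n => (volume : Measure ℝ)) (Finset.univ.erase i) F
      = fun _ => 0 := by
    have := lmarginal_erase' (μ := fun _ : Fin n => (volume : Measure ℝ)) f hfm (Finset.mem_univ i)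
    rw [← this, lmarginal_univ, hf0]
  have h2 : ∫⁻ x, F x ∂(Measure.pi fun _ : Fin n => (volume : Measure ℝ)) = 0 := by
    rw [lintegral_eq_lmarginal_univ (fun _ => 0), lmarginal_erase F hFm (Finset.mem_univ i), h1]
    simp
  have h3 := (lintegral_eq_zero_iff hFm).1 h2
  filter_upwards [show ∀ᵐ x ∂(volume : Measure (Fin n → ℝ)), F x = 0 from h3] with x hx
  have h4 : Measurable fun y => f (Function.update x i y) := hfm.comp (measurable_update x)
  have h5 := (lintegral_eq_zero_iff h4).1 hx
  filter_upwards [h5] with y hy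
  by_contra hcon
  have : Function.update x i y ∈ N := hN hcon
  simp [hf, this] at hy

theorem aux_meas {n : ℕ} (i : Fin n) {g : (Fin n → ℝ) → ℂ} {k : (Fin n → ℝ) × ℝ → ℂ}
    (hk : Measurable k) (hg : AEStronglyMeasurable g (volume : Measure (Fin n → ℝ))) :
    AEStronglyMeasurable (fun x => ∫ y, g (Function.update x i y) * k (x, y))
      (volume : Measure (Fin n → ℝ)) := by
  refine ⟨fun x => ∫ y, hg.mk g (Function.update x i y) * k (x, y), ?_, ?_⟩
  · refine StronglyMeasurable.integral_prod_right'
      (f := fun q : (Fin n → ℝ) × ℝ => hg.mk g (Function.update q.1 i q.2) * k q) ?_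
    exact ((hg.stronglyMeasurable_mk.measurable.comp measurable_update').mul hk).stronglyMeasurable
  · filter_upwards [aux_ae_update i hg.ae_eq_mk] with x hx
    apply integral_congr_ae
    filter_upwards [hx] with y hy
    rw [hy]

theorem aux_Dop_meas {n : ℕ} (i : Fin n) {g : (Fin n → ℝ) → ℂ}
    (hg : AEStronglyMeasurable g (volume : Measure (Fin n → ℝ))) :
    AEStronglyMeasurable (Dop i g) (volume : Measure (Fin n → ℝ)) := by
  have hm : MeasurableSet {q : (Fin n → ℝ) × ℝ | q.2 ≤ q.1 i} :=
    measurableSet_le measurable_snd ((measurable_pi_apply i).comp measurable_fst)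
  have := aux_meas i (k := {q : (Fin n → ℝ) × ℝ | q.2 ≤ q.1 i}.indicator 1)
    (measurable_one.indicator hm) hg
  convert this using 2 with x
  rw [Dop, ← integral_indicator measurableSet_Iic]
  congr 1
  ext y
  by_cases h : y ≤ x i <;> simp [Set.indicator, h]

theorem aux_Eop_meas {n : ℕ} {ρ : ℝ → ℝ} (hρ : Measurable ρ) (i : Fin n) {g : (Fin n → ℝ) → ℂ}
    (hg : AEStronglyMeasurable g (volume : Measure (Fin n → ℝ))) :
    AEStronglyMeasurable (Eop ρ i g) (volume : Measure (Fin n → ℝ)) :=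
  aux_meas i (k := fun q => (ρ q.2 : ℂ))
    (Complex.measurable_ofReal.comp (hρ.comp measurable_snd)) hg

theorem aux_main {n : ℕ} {ρ : ℝ → ℝ} (hρ : Measurable ρ) (hρi : Integrable ρ)
    {f : (Fin n → ℝ) → ENNReal} (hf : Measurable f) {u : (Fin n → ℝ) → ℂ}
    (hu : AEStronglyMeasurable u (volume : Measure (Fin n → ℝ)))
    (huf : ∀ᵐ x ∂(volume : Measure (Fin n → ℝ)), ‖u x‖ₑ ≤ f x) (l : List (Fin n))
    (hl : l.Nodup) :
    AEStronglyMeasurable (l.foldr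
      (fun i acc => fun x => Dop i acc x - Eop ρ i (Dop i acc) x) u)
      (volume : Measure (Fin n → ℝ)) ∧
    ∃ C : ENNReal, C ≠ ⊤ ∧ ∀ᵐ x ∂(volume : Measure (Fin n → ℝ)),
      ‖l.foldr (fun i acc => fun x => Dop i acc x - Eop ρ i (Dop i acc) x) u x‖ₑ
        ≤ C * lmarginal (fun _ : Fin n => (volume : Measure ℝ)) l.toFinset f x := by
  induction l with
  | nil => exact ⟨hu, 1, by simp, by simpa using huf⟩
  | cons i l ih =>
    rw [List.nodup_cons] at hl
    obtain ⟨hm, C, hC, hb⟩ := ih hl.2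
    rw [List.foldr_cons]
    set g := l.foldr (fun i acc => fun x => Dop i acc x - Eop ρ i (Dop i acc) x) u with hg
    have hDm := aux_Dop_meas i hm
    refine ⟨hDm.sub (aux_Eop_meas hρ i hDm), C + C * ∫⁻ y, ‖ρ y‖ₑ, ?_, ?_⟩
    · exact ENNReal.add_ne_top.2 ⟨hC, ENNReal.mul_ne_top hC hρi.2.ne⟩
    set G := lmarginal (fun _ : Fin n => (volume : Measure ℝ)) (i :: l).toFinset f with hG
    have hD : ∀ᵐ x ∂(volume : Measure (Fin n → ℝ)), ‖Dop i g x‖ₑ ≤ C * G x := by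
      filter_upwards [aux_ae_update i hb] with x hx
      calc ‖Dop i g x‖ₑ ≤ ∫⁻ y in Set.Iic (x i), ‖g (Function.update x i y)‖ₑ :=
            enorm_integral_le_lintegral_enorm _
        _ ≤ ∫⁻ y, ‖g (Function.update x i y)‖ₑ := setLIntegral_le_lintegral _ _
        _ ≤ ∫⁻ y, C * lmarginal (fun _ : Fin n => (volume : Measure ℝ)) l.toFinset f
              (Function.update x i y) := lintegral_mono_ae hx
        _ = C * G x := by
            rw [lintegral_const_mul' _ _ hC, hG, List.toFinset_cons,
              lmarginal_insert f hf (by simpa using hl.1)]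
    filter_upwards [hD, aux_ae_update i hD] with x hx hx'
    have hE : ‖Eop ρ i (Dop i g) x‖ₑ ≤ C * G x * ∫⁻ y, ‖ρ y‖ₑ := by
      calc ‖Eop ρ i (Dop i g) x‖ₑ
          ≤ ∫⁻ y, ‖Dop i g (Function.update x i y) * (ρ y : ℂ)‖ₑ :=
            enorm_integral_le_lintegral_enorm _
        _ ≤ ∫⁻ y, C * G x * ‖ρ y‖ₑ := by
            apply lintegral_mono_ae
            filter_upwards [hx'] with y hy
            have hGy : G (Function.update x i y) = G x :=
              lmarginal_update_of_mem (μ := fun _ : Fin n => (volume : Measure ℝ))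
                (by simp) f x y
            rw [hGy] at hy
            rw [enorm_mul]
            gcongr
            exact le_of_eq (by simp [enorm_eq_nnnorm])
        _ = C * G x * ∫⁻ y, ‖ρ y‖ₑ := lintegral_const_mul _ hρ.enorm
    calc _ ≤ ‖Dop i g x‖ₑ + ‖Eop ρ i (Dop i g) x‖ₑ := enorm_sub_le
      _ ≤ C * G x + C * G x * ∫⁻ y, ‖ρ y‖ₑ := add_le_add hx hE
      _ = _ := by ring

/-- with `ρ` a smooth compactly supported function of integral 1, for every
integrable `u : ℝ^n → ℂ`, the function `A(u)` is essentially bounded, i.e. in `L^∞(ℝ^n)`. -/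
theorem stmt5 {n : ℕ} (ρ : ℝ → ℝ)
    (hρ1 : ContDiff ℝ (⊤ : ℕ∞) ρ) (hρ2 : HasCompactSupport ρ) (hρ3 : ∫ t : ℝ, ρ t = 1)
    (u : (Fin n → ℝ) → ℂ) (hu : Integrable u (volume : Measure (Fin n → ℝ))) :
    MemLp (Aop ρ u) ⊤ (volume : Measure (Fin n → ℝ)) := by
  have hfm : Measurable fun x => ‖hu.1.mk u x‖ₑ := hu.1.stronglyMeasurable_mk.measurable.enorm
  obtain ⟨hm, C, hC, hb⟩ := aux_main hρ1.continuous.measurable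
    (hρ1.continuous.integrable_of_hasCompactSupport hρ2) hfm hu.1
    (by filter_upwards [hu.1.ae_eq_mk] with x hx
        rw [hx]) (List.finRange n) (List.nodup_finRange n)
  refine ⟨hm, ?_⟩
  rw [eLpNorm_exponent_top]
  have hI : ∫⁻ x, ‖hu.1.mk u x‖ₑ ∂(Measure.pi fun _ : Fin n => (volume : Measure ℝ)) ≠ ⊤ :=
    (hu.congr hu.1.ae_eq_mk).2.ne
  refine lt_of_le_of_lt (essSup_le_of_ae_le
    (C * ∫⁻ x, ‖hu.1.mk u x‖ₑ ∂(Measure.pi fun _ : Fin n => (volume : Measure ℝ))) ?_)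
    (ENNReal.mul_ne_top hC hI).lt_top
  filter_upwards [hb] with x hx
  rw [List.toFinset_finRange, lmarginal_univ] at hx
  exact hx

end
end

section
/- With ρ and the operator A' = A_1'∘⋯∘A_n' as in the context: let K_0 ⊆ ℝ be a compact interval containing the support of ρ, and let g : ℝ^n → ℂ be integrable with g(x) = 0 for almost every x outside K_0^n. Then A'(g), which is defined at almost every point of ℝ^n, is essentially bounded and vanishes almost everywhere outside K_0^n. -/
open Complex Real MeasureTheory Set

noncomputable section

/-- The operator `C_i(g)(x) = g(x) − ρ(x_i)·∫_ℝ g(x; i↦y) dy`. -/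
def Cop {n : ℕ} (ρ : ℝ → ℝ) (i : Fin n) (g : (Fin n → ℝ) → ℂ) : (Fin n → ℝ) → ℂ :=
  fun x => g x - (ρ (x i) : ℂ) * ∫ y : ℝ, g (Function.update x i y)

/-- The operator `B_i(g)(x) = −∫_{−∞}^{x_i} g(x; i↦y) dy`. -/
def Bop {n : ℕ} (i : Fin n) (g : (Fin n → ℝ) → ℂ) : (Fin n → ℝ) → ℂ :=
  fun x => -∫ y in Set.Iic (x i), g (Function.update x i y)

/-- The operator `A_i' = B_i ∘ C_i`. -/
def Aop' {n : ℕ} (ρ : ℝ → ℝ) (i : Fin n) (g : (Fin n → ℝ) → ℂ) : (Fin n → ℝ) → ℂ :=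
  Bop i (Cop ρ i g)

/-- The operator `A' = A_1'∘⋯∘A_n'`. -/
def Aop'full {n : ℕ} (ρ : ℝ → ℝ) (g : (Fin n → ℝ) → ℂ) : (Fin n → ℝ) → ℂ :=
  (List.finRange n).foldr (fun i acc => Aop' ρ i acc) g

theorem ae_fibre {n : ℕ} (i : Fin n) {P : (Fin n → ℝ) → Prop} (h : ∀ᵐ x : Fin n → ℝ, P x) :
    ∀ᵐ x : Fin n → ℝ, ∀ᵐ y : ℝ, P (Function.update x i y) := by
  obtain ⟨N, hPN, hN, hN0⟩ := exists_measurable_superset_of_null (ae_iff.1 h)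
  have hf : Measurable (N.indicator (fun _ => (1 : ENNReal))) := measurable_const.indicator hN
  have hm : Measurable (fun x : Fin n → ℝ =>
      ∫⁻ y : ℝ, N.indicator (fun _ => (1 : ENNReal)) (Function.update x i y)) := by
    have := hf.lmarginal (fun _ : Fin n => (volume : Measure ℝ)) (s := {i})
    convert this using 2 with x
    rw [lmarginal_singleton]
  have h0 : ∫⁻ x : Fin n → ℝ, N.indicator (fun _ => (1 : ENNReal)) x = 0 := by
    rw [lintegral_indicator hN]; simp [hN0]
  have hins : (Finset.univ : Finset (Fin n)) = insert i (Finset.univ.erase i) := by simp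
  have hz : ∫⁻ x : Fin n → ℝ,
      ∫⁻ y : ℝ, N.indicator (fun _ => (1 : ENNReal)) (Function.update x i y) = 0 := by
    have h1 : ∀ x, lmarginal (fun _ : Fin n => (volume : Measure ℝ)) (Finset.univ.erase i)
        (fun x => ∫⁻ y : ℝ, N.indicator (fun _ => (1 : ENNReal)) (Function.update x i y)) x = 0 := by
      intro x
      rw [← lmarginal_insert' _ hf (Finset.notMem_erase i _), ← hins, lmarginal_univ]
      exact h0
    have h2 := lintegral_eq_lmarginal_univ (μ := fun _ : Fin n => (volume : Measure ℝ))
      (f := fun x => ∫⁻ y : ℝ, N.indicator (fun _ => (1 : ENNReal)) (Function.update x i y)) 0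
    rw [volume_pi, h2, hins, lmarginal_insert _ hm (Finset.notMem_erase i _)]
    simp [h1]
  rw [lintegral_eq_zero_iff hm] at hz
  filter_upwards [hz] with x hx
  have hm' : Measurable (fun y : ℝ =>
      N.indicator (fun _ => (1 : ENNReal)) (Function.update x i y)) :=
    hf.comp (measurable_update x)
  have hx' := (lintegral_eq_zero_iff hm').1 hx
  filter_upwards [hx'] with y hy
  by_contra hP
  have : Function.update x i y ∈ N := hPN hP
  simp [this] at hy

theorem Aop'_eq {n : ℕ} (ρ : ℝ → ℝ) (i : Fin n) (h : (Fin n → ℝ) → ℂ) (x : Fin n → ℝ) :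
    Aop' ρ i h x = -∫ y in Set.Iic (x i), (h (Function.update x i y) -
      (ρ y : ℂ) * ∫ z : ℝ, h (Function.update x i z)) := by
  simp [Aop', Bop, Cop]

theorem Aop'_congr {n : ℕ} (ρ : ℝ → ℝ) (i : Fin n) {h h' : (Fin n → ℝ) → ℂ}
    (hh : h =ᵐ[volume] h') : Aop' ρ i h =ᵐ[volume] Aop' ρ i h' := by
  filter_upwards [ae_fibre i hh] with x hx
  rw [Aop'_eq, Aop'_eq, integral_congr_ae hx]
  congr 1
  apply integral_congr_ae
  filter_upwards [ae_restrict_of_ae hx] with y hy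
  rw [hy]

theorem sm_int {n : ℕ} (i : Fin n) {h : (Fin n → ℝ) → ℂ} (hh : StronglyMeasurable h) :
    StronglyMeasurable (fun x : Fin n → ℝ => ∫ z : ℝ, h (Function.update x i z)) := by
  apply StronglyMeasurable.integral_prod_right (f := fun x z => h (Function.update x i z))
  exact hh.comp_measurable measurable_update'

theorem Aop'_sm {n : ℕ} (ρ : ℝ → ℝ) (hρ : Measurable ρ) (i : Fin n) {h : (Fin n → ℝ) → ℂ}
    (hh : StronglyMeasurable h) : StronglyMeasurable (Aop' ρ i h) := by
  have hC : StronglyMeasurable (Cop ρ i h) := by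
    apply hh.sub
    apply StronglyMeasurable.mul _ (sm_int i hh)
    exact (Complex.measurable_ofReal.comp (hρ.comp (measurable_pi_apply i))).stronglyMeasurable
  unfold Aop' Bop
  apply StronglyMeasurable.neg
  have : (fun x : Fin n → ℝ => ∫ y in Set.Iic (x i), Cop ρ i h (Function.update x i y)) =
      fun x => ∫ y, ({p : (Fin n → ℝ) × ℝ | p.2 ≤ p.1 i}.indicator
        (fun p => Cop ρ i h (Function.update p.1 i p.2))) (x, y) := by
    funext x
    rw [← integral_indicator measurableSet_Iic]
    congr 1
  rw [this]
  apply StronglyMeasurable.integral_prod_right' (f := ({p : (Fin n → ℝ) × ℝ | p.2 ≤ p.1 i}.indicator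
        (fun p => Cop ρ i h (Function.update p.1 i p.2))))
  apply StronglyMeasurable.indicator
  · exact hC.comp_measurable measurable_update'
  · exact measurableSet_le measurable_snd ((measurable_pi_apply i).comp measurable_fst)

theorem Aop'_bound {n : ℕ} (ρ : ℝ → ℝ) (hρ : Measurable ρ) (i : Fin n) (h : (Fin n → ℝ) → ℂ)
    (x : Fin n → ℝ) :
    ‖Aop' ρ i h x‖ₑ ≤ (1 + ∫⁻ y, ‖ρ y‖ₑ) * ∫⁻ y : ℝ, ‖h (Function.update x i y)‖ₑ := by
  rw [Aop'_eq, enorm_neg]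
  set I := ∫ z : ℝ, h (Function.update x i z) with hI
  calc _ ≤ ∫⁻ y in Set.Iic (x i), ‖h (Function.update x i y) - (ρ y : ℂ) * I‖ₑ :=
        enorm_integral_le_lintegral_enorm _
    _ ≤ ∫⁻ y, ‖h (Function.update x i y) - (ρ y : ℂ) * I‖ₑ := setLIntegral_le_lintegral _ _
    _ ≤ ∫⁻ y, (‖h (Function.update x i y)‖ₑ + ‖ρ y‖ₑ * ‖I‖ₑ) := by
        apply lintegral_mono
        intro y
        refine enorm_sub_le.trans ?_
        have hre : ‖(ρ y : ℂ)‖ₑ = ‖ρ y‖ₑ := by simp [enorm_eq_nnnorm]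
        rw [enorm_mul, hre]
    _ = (∫⁻ y, ‖h (Function.update x i y)‖ₑ) + (∫⁻ y, ‖ρ y‖ₑ) * ‖I‖ₑ := by
        rw [lintegral_add_right _ (hρ.enorm.mul_const _), lintegral_mul_const _ hρ.enorm]
    _ ≤ _ := by
        rw [add_mul, one_mul]
        gcongr
        exact enorm_integral_le_lintegral_enorm _

theorem Aop'_vanish {n : ℕ} (ρ : ℝ → ℝ) (hρi : Integrable ρ) (hρ3 : ∫ t : ℝ, ρ t = 1)
    (c d : ℝ) (hKρ : tsupport ρ ⊆ Set.Icc c d) (i : Fin n) {h : (Fin n → ℝ) → ℂ}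
    (hh : ∀ᵐ x : Fin n → ℝ, x ∉ Set.univ.pi (fun _ : Fin n => Set.Icc c d) → h x = 0) :
    ∀ᵐ x : Fin n → ℝ, x ∉ Set.univ.pi (fun _ : Fin n => Set.Icc c d) → Aop' ρ i h x = 0 := by
  have hρ0 : ∀ y, y ∉ Set.Icc c d → ρ y = 0 := fun y hy =>
    image_eq_zero_of_notMem_tsupport (fun hy' => hy (hKρ hy'))
  filter_upwards [ae_fibre i hh] with x hx hxK
  have hx1 : ∀ᵐ y : ℝ, y ∉ Set.Icc c d → h (Function.update x i y) = 0 := by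
    filter_upwards [hx] with y hy hyK
    apply hy
    intro hmem
    have := hmem i (Set.mem_univ i)
    simp only [Function.update_self] at this
    exact hyK this
  rw [Aop'_eq, neg_eq_zero]
  by_cases hxi : x i ∈ Set.Icc c d
  · obtain ⟨j, hj⟩ : ∃ j, x j ∉ Set.Icc c d := by
      by_contra hcon
      push Not at hcon
      exact hxK (fun j _ => hcon j)
    have hji : j ≠ i := by rintro rfl; exact hj hxi
    have hz : ∀ᵐ y : ℝ, h (Function.update x i y) = 0 := by
      filter_upwards [hx] with y hy
      apply hy
      intro hmem
      have := hmem j (Set.mem_univ j)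
      rw [Function.update_of_ne hji] at this
      exact hj this
    have hI : ∫ z : ℝ, h (Function.update x i z) = 0 := integral_eq_zero_of_ae hz
    rw [hI]
    apply integral_eq_zero_of_ae
    filter_upwards [ae_restrict_of_ae hz] with y hy
    simp [hy]
  · set I := ∫ z : ℝ, h (Function.update x i z) with hI
    by_cases hlt : x i < c
    · apply integral_eq_zero_of_ae
      filter_upwards [ae_restrict_of_ae hx1, ae_restrict_mem measurableSet_Iic] with y hy hyi
      have hyK : y ∉ Set.Icc c d := fun hyc => absurd (hyc.1.trans hyi) (not_le.2 hlt)
      simp [hy hyK, hρ0 y hyK]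
    · have hgt : d < x i := by
        by_contra hcon
        exact hxi ⟨not_lt.1 hlt, not_lt.1 hcon⟩
      have hfull : ∫ y in Set.Iic (x i), (h (Function.update x i y) - (ρ y : ℂ) * I) =
          ∫ y, (h (Function.update x i y) - (ρ y : ℂ) * I) := by
        apply setIntegral_eq_integral_of_ae_compl_eq_zero
        filter_upwards [hx1] with y hy hyi
        have hyK : y ∉ Set.Icc c d := fun hyc => hyi (hyc.2.trans hgt.le)
        simp [hy hyK, hρ0 y hyK]
      rw [hfull]
      by_cases hI0 : I = 0
      · simp only [hI0, mul_zero, sub_zero]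
        rw [← hI, hI0]
      · have hint : Integrable (fun z : ℝ => h (Function.update x i z)) := by
          by_contra hcon
          exact hI0 (integral_undef hcon)
        have hρI : Integrable (fun y : ℝ => (ρ y : ℂ) * I) := hρi.ofReal.mul_const I
        rw [integral_sub hint hρI, integral_mul_const, ← hI]
        have : ∫ y, (ρ y : ℂ) = 1 := by
          rw [integral_complex_ofReal, hρ3]; simp
        rw [this]; simp

/-- with `ρ` a smooth compactly supported function of integral 1 and
`K₀ = [c,d]` a compact interval containing the support of `ρ`: if `g : ℝ^n → ℂ` is
integrable with `g = 0` a.e. outside `K₀^n`, then `A'(g)` is essentially bounded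
(in `L^∞`) and vanishes a.e. outside `K₀^n`. -/
theorem stmt11 {n : ℕ} (ρ : ℝ → ℝ)
    (hρ1 : ContDiff ℝ (⊤ : ℕ∞) ρ) (hρ2 : HasCompactSupport ρ) (hρ3 : ∫ t : ℝ, ρ t = 1)
    (c d : ℝ) (hcd : c ≤ d) (hKρ : tsupport ρ ⊆ Set.Icc c d)
    (g : (Fin n → ℝ) → ℂ) (hint : Integrable g (volume : Measure (Fin n → ℝ)))
    (hgsupp : ∀ᵐ x : Fin n → ℝ,
      x ∉ Set.univ.pi (fun _ : Fin n => Set.Icc c d) → g x = 0) :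
    MemLp (Aop'full ρ g) ⊤ (volume : Measure (Fin n → ℝ)) ∧
    ∀ᵐ x : Fin n → ℝ,
      x ∉ Set.univ.pi (fun _ : Fin n => Set.Icc c d) → Aop'full ρ g x = 0 := by
  have hρm : Measurable ρ := hρ1.continuous.measurable
  have hρi : Integrable ρ := hρ1.continuous.integrable_of_hasCompactSupport hρ2
  set f : (Fin n → ℝ) → ENNReal := fun x => ‖hint.1.mk g x‖ₑ with hfdef
  have hf : Measurable f := hint.1.stronglyMeasurable_mk.measurable.enorm
  have hfint : ∫⁻ x, f x < ⊤ := (hint.congr hint.1.ae_eq_mk).2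
  have key : ∀ l : List (Fin n), l.Nodup →
      AEStronglyMeasurable (l.foldr (fun i acc => Aop' ρ i acc) g) volume ∧
      (∀ᵐ x : Fin n → ℝ, x ∉ Set.univ.pi (fun _ : Fin n => Set.Icc c d) →
        l.foldr (fun i acc => Aop' ρ i acc) g x = 0) ∧
      ∃ C : ENNReal, C ≠ ⊤ ∧ ∀ᵐ x : Fin n → ℝ, ‖l.foldr (fun i acc => Aop' ρ i acc) g x‖ₑ ≤
        C * lmarginal (fun _ : Fin n => (volume : Measure ℝ)) l.toFinset f x := by
    intro l
    induction l with
    | nil =>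
      intro _
      refine ⟨hint.1, hgsupp, 1, by simp, ?_⟩
      filter_upwards [hint.1.ae_eq_mk] with x hx
      simp [hfdef, ← hx]
    | cons i l ih =>
      intro hl
      rw [List.nodup_cons] at hl
      obtain ⟨h1, h2, C, hC, h3⟩ := ih hl.2
      simp only [List.foldr_cons]
      set h := l.foldr (fun i acc => Aop' ρ i acc) g
      refine ⟨?_, Aop'_vanish ρ hρi hρ3 c d hKρ i h2, (1 + ∫⁻ y, ‖ρ y‖ₑ) * C,
        ENNReal.mul_ne_top (ENNReal.add_ne_top.2 ⟨by simp, hρi.2.ne⟩) hC, ?_⟩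
      · exact ⟨_, Aop'_sm ρ hρm i h1.stronglyMeasurable_mk, Aop'_congr ρ i h1.ae_eq_mk⟩
      · filter_upwards [ae_fibre i h3] with x hx
        refine (Aop'_bound ρ hρm i h x).trans ?_
        have hmu : Measurable (fun y : ℝ => lmarginal (fun _ : Fin n => (volume : Measure ℝ))
            l.toFinset f (Function.update x i y)) :=
          (hf.lmarginal _).comp (measurable_update x)
        rw [mul_assoc, List.toFinset_cons, lmarginal_insert _ hf (by simpa using hl.1),
          ← lintegral_const_mul _ hmu]
        gcongr 1
        exact lintegral_mono_ae hx
  obtain ⟨h1, h2, C, hC, h3⟩ := key (List.finRange n) (List.nodup_finRange n)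
  refine ⟨⟨h1, ?_⟩, h2⟩
  rw [eLpNorm_exponent_top]
  refine lt_of_le_of_lt (essSup_le_of_ae_le (C * ∫⁻ x, f x) ?_)
    (ENNReal.mul_lt_top hC.lt_top hfint)
  filter_upwards [h3] with x hx
  have huniv : (List.finRange n).toFinset = Finset.univ := by ext; simp
  rw [huniv, lmarginal_univ] at hx
  exact hx

end
end
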